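/- The alternating lexicographic order ≤_alt on {0,1}^∞ is a cylinder order whose smallest accumulation point m_alt := m_{≤_alt} satisfies m_alt = τ_{0,2}(m_alt), i.e., m_alt is the fixed point 100111001001001110011⋯ of the substitution 0 ↦ 1, 1 ↦ 100 (that is, τ_{0,2}), and moreover {a ∈ M_{≤_alt} : a <_alt m_alt} = {(τ_{0,2}^n(0))^∞ : n ≥ 0} = {0^∞, 1^∞, (100)^∞, (10011)^∞, …}. -/

import Mathlib

open scoped Classical

noncomputable section

/-- The ultrametric on infinite words: `d(a,b) = 2^{-min{n ≥ 1 : a_n ≠ b_n}}`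
(words are indexed from 0 here, so position `i` corresponds to `n = i+1`). -/
noncomputable def wdist {A : Type*} [DecidableEq A] (a b : ℕ → A) : ℝ :=
  if h : ∃ n, a n ≠ b n then (2 : ℝ)⁻¹ ^ (Nat.find h + 1) else 0

/-- The tail `a_{k+1} a_{k+2} ⋯` of an infinite word. -/
def shiftn {A : Type*} (a : ℕ → A) (k : ℕ) : ℕ → A := fun n => a (n + k)

/-- The set of tails of an infinite word (including the word itself). -/
def tails {A : Type*} (a : ℕ → A) : Set (ℕ → A) := {b | ∃ k, b = shiftn a k}

/-- A cylinder order: a total order such that `a ≤ b ≤ c` implies `d(a,b) ≤ d(a,c)`. -/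
def IsCylOrder {A : Type*} [DecidableEq A] (le : (ℕ → A) → (ℕ → A) → Prop) : Prop :=
  (∀ a b, le a b ∨ le b a) ∧
  (∀ a b, le a b → le b a → a = b) ∧
  (∀ a b c, le a b → le b c → le a c) ∧
  (∀ a b c, le a b → le b c → wdist a b ≤ wdist a c)

/-- Strict comparison associated to an order relation. -/
def wlt {A : Type*} (le : (ℕ → A) → (ℕ → A) → Prop) (a b : ℕ → A) : Prop :=
  le a b ∧ a ≠ b

/-- `m` is the least upper bound of the set `s` with respect to `le`. -/
def IsSupOf {A : Type*} (le : (ℕ → A) → (ℕ → A) → Prop) (s : Set (ℕ → A))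
    (m : ℕ → A) : Prop :=
  (∀ x ∈ s, le x m) ∧ ∀ b, (∀ x ∈ s, le x b) → le m b

/-- The set `M_≤ = {s_≤(a) : a ∈ A^∞}` of sup-words. -/
def supWords {A : Type*} (le : (ℕ → A) → (ℕ → A) → Prop) : Set (ℕ → A) :=
  {m | ∃ a, IsSupOf le (tails a) m}

/-- `x` is an accumulation point of `M` in the metric `wdist`. -/
def IsAccPt' {A : Type*} [DecidableEq A] (M : Set (ℕ → A)) (x : ℕ → A) : Prop :=
  ∀ ε : ℝ, 0 < ε → ∃ y ∈ M, y ≠ x ∧ wdist x y < ε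

/-- `x` is the smallest (w.r.t. `le`) accumulation point of `M`. -/
def IsSmallestAcc {A : Type*} [DecidableEq A] (le : (ℕ → A) → (ℕ → A) → Prop)
    (M : Set (ℕ → A)) (x : ℕ → A) : Prop :=
  IsAccPt' M x ∧ ∀ y, IsAccPt' M y → le x y

/-- Membership in the cylinder given by the finite word `w`. -/
def inCyl {A : Type*} (w : List A) (a : ℕ → A) : Prop :=
  ∀ i : Fin w.length, a i.val = w.get i

/-- `[u] < [v]` for cylinders: every element of `[u]` is strictly below every element of `[v]`. -/
def cylLt {A : Type*} (le : (ℕ → A) → (ℕ → A) → Prop) (u v : List A) : Prop :=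
  ∀ a b, inCyl u a → inCyl v b → wlt le a b

/-- Infinite binary words. -/
abbrev W2 := ℕ → Bool

/-- The word `0^∞`. -/
def w0 : W2 := fun _ => false

/-- The word `1^∞`. -/
def w1 : W2 := fun _ => true

/-- The word `10^∞`. -/
def w10inf : W2 := fun n => decide (n = 0)

/-- The periodic word `w^∞` for a finite word `w`. -/
def perW (w : List Bool) : W2 := fun n => w.getD (n % w.length) false

/-- A substitution on `{0,1}`, given by the images of the two letters. -/
abbrev Sub2 := Bool → List Bool

/-- Action of a substitution on finite words. -/
def listApply (f : Sub2) (l : List Bool) : List Bool := (l.map f).flatten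

/-- Action of a (nonerasing) substitution on infinite words. -/
def subApply (f : Sub2) (a : W2) : W2 :=
  fun n => (listApply f (List.ofFn (fun i : Fin (n + 1) => a i.val))).getD n false

/-- The substitution `τ_{j,k} : 0 ↦ 10^j, 1 ↦ 10^k`. -/
def tauS (j k : ℕ) : Sub2 := fun b => true :: List.replicate (if b then k else j) false

/-- Membership in the set `S = {τ_{j,k} : 0 ≤ j < k}`. -/
def memS (f : Sub2) : Prop := ∃ j k : ℕ, j < k ∧ f = tauS j k

/-- Apply a finite composition `σ_1 ∘ ⋯ ∘ σ_n` (given as a list) to an infinite word. -/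
def applyList (L : List Sub2) (a : W2) : W2 := L.foldr subApply a

/-- Apply a finite composition `σ_1 ∘ ⋯ ∘ σ_n` (given as a list) to a finite word. -/
def listApplyL (L : List Sub2) (l : List Bool) : List Bool := L.foldr listApply l

/-- `σ_{[1,n]} = σ_1 ∘ ⋯ ∘ σ_n` applied to an infinite word, for `σ ∈ S^∞`
(indexed from 0 in Lean). -/
def compUpTo (σ : ℕ → Sub2) (n : ℕ) (a : W2) : W2 :=
  applyList (List.ofFn (fun i : Fin n => σ i.val)) a

/-- `m` is the limit word `lim_{n → ∞} σ_{[1,n]}(a)`. -/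
def IsLimitWord (σ : ℕ → Sub2) (a m : W2) : Prop :=
  ∀ ε : ℝ, 0 < ε → ∃ N : ℕ, ∀ n ≥ N, wdist (compUpTo σ n a) m < ε

/-- Strict alternating lexicographic order on `{0,1}^∞`: at the first differing position
`i` (0-indexed, so the paper's index `n = i+1`), `a <_alt b` iff `a_i < b_i` and `i+1` is
odd (i.e. `i` even), or `a_i > b_i` and `i+1` is even (i.e. `i` odd). -/
def altLt (a b : W2) : Prop :=
  ∃ i : ℕ, (∀ m < i, a m = b m) ∧
    (if Even i then a i = false ∧ b i = true else a i = true ∧ b i = false)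

/-- The alternating lexicographic order on `{0,1}^∞`. -/
def altLe (a b : W2) : Prop := a = b ∨ altLt a b

/-- The finite word `τ_{0,2}^n(0)`. -/
def tauIter02 : ℕ → List Bool
  | 0 => [false]
  | n + 1 => listApply (tauS 0 2) (tauIter02 n)

/-! ### The alternating lexicographic order -/

lemma altLt_trichotomy (a b : W2) : altLt a b ∨ a = b ∨ altLt b a := by
  by_cases h : a = b
  · exact .inr (.inl h)
  have h' : ∃ n, a n ≠ b n := Function.ne_iff.mp h
  have hlt : ∀ m < Nat.find h', a m = b m := fun m hm => not_not.mp (Nat.find_min h' hm)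
  have hne := Nat.find_spec h'
  generalize Nat.find h' = i at hlt hne
  by_cases hi : Even i <;> cases ha : a i <;> cases hb : b i
  all_goals first
    | exact absurd (ha.trans hb.symm) hne
    | (left; refine ⟨i, hlt, ?_⟩; simp [hi, ha, hb]; done)
    | exact .inr (.inr ⟨i, fun m hm => (hlt m hm).symm, by simp [hi, ha, hb]⟩)

lemma altLt_irrefl (a : W2) : ¬ altLt a a := by
  rintro ⟨i, -, h⟩
  split_ifs at h <;> simp_all

lemma altLt_trans {a b c : W2} (hab : altLt a b) (hbc : altLt b c) : altLt a c := by
  obtain ⟨i, hi, hi'⟩ := hab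
  obtain ⟨j, hj, hj'⟩ := hbc
  rcases lt_trichotomy i j with h | h | h
  · exact ⟨i, fun m hm => (hi m hm).trans (hj m (hm.trans h)), by rwa [← hj i h]⟩
  · subst h
    split_ifs at hi' hj' <;> simp_all
  · exact ⟨j, fun m hm => (hi m (hm.trans h)).trans (hj m hm), by rwa [hi j h]⟩

lemma altLe_total (a b : W2) : altLe a b ∨ altLe b a := by
  rcases altLt_trichotomy a b with h | h | h
  · exact .inl (.inr h)
  · exact .inl (.inl h)
  · exact .inr (.inr h)

lemma altLt.not_altLe {a b : W2} (h : altLt a b) : ¬ altLe b a := by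
  rintro (rfl | h')
  · exact altLt_irrefl _ h
  · exact altLt_irrefl _ (altLt_trans h h')

lemma altLe_antisymm {a b : W2} (hab : altLe a b) (hba : altLe b a) : a = b :=
  hab.resolve_right fun h => h.not_altLe hba

lemma altLe_trans {a b c : W2} (hab : altLe a b) (hbc : altLe b c) : altLe a c := by
  rcases hab with rfl | hab
  · exact hbc
  rcases hbc with rfl | hbc
  · exact .inr hab
  · exact .inr (altLt_trans hab hbc)

lemma altLt_of_not_altLe {a b : W2} (h : ¬ altLe a b) : altLt b a := by
  rcases altLt_trichotomy a b with h' | h' | h'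
  · exact absurd (.inr h') h
  · exact absurd (.inl h') h
  · exact h'

/-- If `a ≤ b ≤ c` and `a`, `c` agree below `N`, then so do `a` and `b`. -/
lemma agree_of_altLe_of_altLe {a b c : W2} (hab : altLe a b) (hbc : altLe b c) {N : ℕ}
    (h : ∀ i < N, a i = c i) : ∀ i < N, a i = b i := by
  rcases hab with rfl | ⟨j, hj, hj'⟩
  · exact fun _ _ => rfl
  intro i hi
  by_contra hne
  have hji : j ≤ i := not_lt.mp fun hij => hne (hj i hij)
  refine altLt.not_altLe ⟨j, fun m hm => ?_, ?_⟩ hbc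
  · rw [← h m (by omega), hj m hm]
  · rwa [← h j (by omega)]

lemma wdist_nonneg {A : Type*} [DecidableEq A] (a b : ℕ → A) : 0 ≤ wdist a b := by
  unfold wdist
  split_ifs <;> positivity

lemma wdist_lt_of_agree {A : Type*} [DecidableEq A] {a b : ℕ → A} {N : ℕ}
    (h : ∀ i < N, a i = b i) : wdist a b < (2 : ℝ)⁻¹ ^ N := by
  unfold wdist
  split_ifs with h'
  · refine pow_lt_pow_right_of_lt_one₀ (by norm_num) (by norm_num) (Nat.lt_succ_of_le ?_)
    exact not_lt.mp fun hlt => Nat.find_spec h' (h _ hlt)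
  · positivity

lemma agree_of_wdist_lt {A : Type*} [DecidableEq A] {a b : ℕ → A} {N : ℕ}
    (h : wdist a b < (2 : ℝ)⁻¹ ^ N) : ∀ i < N, a i = b i := by
  unfold wdist at h
  split_ifs at h with h'
  · have := (pow_lt_pow_iff_right_of_lt_one₀ (by norm_num) (by norm_num)).mp h
    exact fun i hi => not_not.mp (Nat.find_min h' (by omega))
  · exact fun i _ => not_not.mp fun hne => h' ⟨i, hne⟩

lemma wdist_le_of_agree_imp {A : Type*} [DecidableEq A] {a b c : ℕ → A}
    (h : ∀ N, (∀ i < N, a i = c i) → ∀ i < N, a i = b i) : wdist a b ≤ wdist a c := by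
  by_cases hac : ∃ n, a n ≠ c n
  · have hb := h (Nat.find hac) fun i hi => not_not.mp (Nat.find_min hac hi)
    unfold wdist
    rw [dif_pos hac]
    split_ifs with hab
    · refine pow_le_pow_of_le_one (by norm_num) (by norm_num) (Nat.succ_le_succ ?_)
      exact not_lt.mp fun hlt => Nat.find_spec hab (hb _ hlt)
    · positivity
  · push Not at hac
    have hab : a = b := funext fun i => h (i + 1) (fun j _ => hac j) i (Nat.lt_succ_self i)
    subst hab
    simpa [wdist] using wdist_nonneg a c

lemma isCylOrder_altLe : IsCylOrder altLe :=
  ⟨altLe_total, fun _ _ => altLe_antisymm, fun _ _ _ => altLe_trans, fun _ _ _ hab hbc =>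
    wdist_le_of_agree_imp fun _ => agree_of_altLe_of_altLe hab hbc⟩

/-! ### Sup-words are the words dominating their own tails -/

lemma shiftn_zero {A : Type*} (a : ℕ → A) : shiftn a 0 = a := rfl

lemma shiftn_shiftn {A : Type*} (a : ℕ → A) (j k : ℕ) :
    shiftn (shiftn a j) k = shiftn a (j + k) := by
  funext n
  simp only [shiftn]
  congr 1
  omega

/-- Every prefix of a supremum of a nonempty set is a prefix of an element of the set. -/
lemma IsSupOf.exists_agree {s : Set W2} {m : W2} (hs : s.Nonempty) (h : IsSupOf altLe s m)
    (N : ℕ) : ∃ t ∈ s, ∀ i < N, t i = m i := by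
  induction N with
  | zero => exact ⟨hs.some, hs.some_mem, by simp⟩
  | succ n ih =>
    by_contra! hcon
    obtain ⟨t, ht, htm⟩ := ih
    have key : ∀ t ∈ s, (∀ i < n, t i = m i) → t n ≠ m n := by
      intro t ht htm hn
      obtain ⟨i, hi, hne⟩ := hcon t ht
      rcases Nat.lt_succ_iff_lt_or_eq.mp hi with h' | rfl
      · exact hne (htm i h')
      · exact hne hn
    let b : W2 := fun i => if i < n then m i else if i = n then !(m n) else decide (Even i)
    have hb_lt : ∀ i < n, b i = m i := fun i hi => by simp [b, hi]
    have hb_n : b n = !(m n) := by simp [b]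
    have hb_gt : ∀ i, n < i → b i = decide (Even i) := fun i hi => by
      simp [b, not_lt.mpr hi.le, hi.ne']
    have hbm : altLt b m := by
      obtain ⟨j, hj, hj'⟩ := (h.1 t ht).resolve_left fun h' => key t ht htm (by rw [h'])
      have hjn : j = n := by
        rcases lt_trichotomy j n with h' | h' | h'
        · rw [htm j h'] at hj'
          split_ifs at hj' <;> simp_all
        · exact h'
        · exact absurd (hj n h') (key t ht htm)
      subst hjn
      refine ⟨j, hb_lt, ?_⟩
      rw [hb_n]
      split_ifs at hj' ⊢ <;> simp [hj'.2]
    refine hbm.not_altLe (h.2 b fun t ht => ?_)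
    by_cases htm : ∀ i < n, t i = m i
    · have htn : t n = b n := by
        rw [hb_n]
        exact Bool.eq_not_of_ne (key t ht htm)
      by_contra hle
      obtain ⟨j, hj, hj'⟩ := altLt_of_not_altLe hle
      have hnj : n < j := by
        by_contra hjn
        have : b j = t j := by
          rcases (not_lt.mp hjn).lt_or_eq with h' | rfl
          · rw [hb_lt j h', htm j h']
          · exact htn.symm
        rw [this] at hj'
        split_ifs at hj' <;> simp_all
      rw [hb_gt j hnj] at hj'
      split_ifs at hj' with hev <;> simp [hev] at hj'
    · obtain ⟨j, hj, hj'⟩ := (h.1 t ht).resolve_left fun h' => htm fun i _ => by rw [h']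
      have hjn : j < n := by
        by_contra hjn
        exact htm fun i hi => hj i (by omega)
      exact .inr ⟨j, fun i hi => by rw [hj i hi, hb_lt i (hi.trans hjn)], by
        rwa [hb_lt j hjn]⟩

lemma mem_supWords_iff {m : W2} : m ∈ supWords altLe ↔ ∀ k, altLe (shiftn m k) m := by
  constructor
  · rintro ⟨a, ha⟩ k
    by_contra hle
    obtain ⟨j, hj, hj'⟩ := altLt_of_not_altLe hle
    obtain ⟨_, ⟨l, rfl⟩, hl⟩ := IsSupOf.exists_agree (s := tails a) ⟨a, 0, rfl⟩ ha (j + k + 1)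
    have hagree : ∀ i < j + 1, shiftn a (l + k) i = shiftn m k i := by
      intro i hi
      rw [← shiftn_shiftn]
      exact hl (i + k) (by omega)
    refine altLt.not_altLe ⟨j, fun i hi => ?_, ?_⟩ (ha.1 _ ⟨l + k, rfl⟩)
    · rw [hagree i (by omega), hj i hi]
    · rwa [hagree j (by omega)]
  · intro h
    refine ⟨m, ?_, fun b hb => hb m ⟨0, rfl⟩⟩
    rintro _ ⟨k, rfl⟩
    exact h k

/-! ### The substitution `0 ↦ 1, 1 ↦ 100` on infinite words -/

/-- Prepend a letter to an infinite word. -/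
def wcons (x : Bool) (a : W2) : W2
  | 0 => x
  | n + 1 => a n

lemma wcons_head_tail (a : W2) : wcons (a 0) (shiftn a 1) = a := by
  funext n
  cases n <;> rfl

/-- Prepend a finite word to an infinite word. -/
def wappend (l : List Bool) (a : W2) : W2 := l.foldr wcons a

lemma altLt.wcons {a b : W2} (x : Bool) (h : altLt b a) : altLt (wcons x a) (wcons x b) := by
  obtain ⟨i, hi, hi'⟩ := h
  refine ⟨i + 1, fun m hm => ?_, ?_⟩
  · cases m with
    | zero => rfl
    | succ m => exact (hi m (by omega)).symm
  · simp only [Nat.even_add_one, _root_.wcons]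
    split_ifs at hi' ⊢ <;> simp_all

lemma length_le_length_listApply_tauS (j k : ℕ) (l : List Bool) :
    l.length ≤ (listApply (tauS j k) l).length := by
  induction l with
  | nil => simp
  | cons x l ih =>
    simp only [listApply, tauS, List.map_cons, List.flatten_cons, List.length_append,
      List.length_cons] at ih ⊢
    omega

lemma listApply_append (f : Sub2) (l l' : List Bool) :
    listApply f (l ++ l') = listApply f l ++ listApply f l' := by
  simp [listApply]

lemma subApply_tauS_eq (j k : ℕ) (a : W2) {n N : ℕ} (h : n < N) :
    subApply (tauS j k) a n =
      (listApply (tauS j k) (List.ofFn fun i : Fin N => a i.val)).getD n false := by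
  obtain ⟨d, rfl⟩ := Nat.exists_eq_add_of_lt h
  rw [show n + d + 1 = (n + 1) + d by omega, List.ofFn_add, listApply_append]
  rw [List.getD_append _ _ _ _ ?_]
  · rfl
  · refine lt_of_lt_of_le ?_ (length_le_length_listApply_tauS _ _ _)
    simp

lemma subApply_tauS_wcons (j k : ℕ) (x : Bool) (a : W2) :
    subApply (tauS j k) (wcons x a) = wappend (tauS j k x) (subApply (tauS j k) a) := by
  have happ : ∀ (l l' : List Bool) (b : W2) (n : ℕ),
      (∀ i, i + l.length = n → b i = l'.getD i false) →
      wappend l b n = (l ++ l').getD n false := by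
    intro l l' b
    induction l with
    | nil => intro n h; exact h n rfl
    | cons y l ih =>
      intro n h
      cases n with
      | zero => rfl
      | succ n =>
        simpa [wappend, wcons] using ih n fun i hi => h i (by simp; omega)
  funext n
  rw [happ (tauS j k x) (listApply (tauS j k) (List.ofFn fun i : Fin n => a i.val))]
  · simp only [subApply, List.ofFn_succ]
    rfl
  · intro i hi
    refine subApply_tauS_eq j k a ?_
    simp only [tauS, List.length_cons] at hi
    omega

/-- The action of `0 ↦ 1, 1 ↦ 100` on infinite words. -/
abbrev T (a : W2) : W2 := subApply (tauS 0 2) a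

lemma T_wcons_false (a : W2) : T (wcons false a) = wcons true (T a) :=
  subApply_tauS_wcons 0 2 false a

lemma T_wcons_true (a : W2) :
    T (wcons true a) = wcons true (wcons false (wcons false (T a))) :=
  subApply_tauS_wcons 0 2 true a

lemma T_of_false {a : W2} (h : a 0 = false) : T a = wcons true (T (shiftn a 1)) := by
  rw [← T_wcons_false, ← h, wcons_head_tail]

lemma T_of_true {a : W2} (h : a 0 = true) :
    T a = wcons true (wcons false (wcons false (T (shiftn a 1)))) := by
  rw [← T_wcons_true, ← h, wcons_head_tail]

lemma T_zero (a : W2) : T a 0 = true := by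
  cases h : a 0
  · rw [T_of_false h]; rfl
  · rw [T_of_true h]; rfl

lemma altLt.T {a b : W2} (h : altLt a b) : altLt (T a) (T b) := by
  obtain ⟨i, hi, hi'⟩ := h
  induction i generalizing a b with
  | zero =>
    simp only [Even.zero, if_true] at hi'
    rw [T_of_false hi'.1, T_of_true hi'.2]
    refine altLt.wcons _ ⟨0, by simp, ?_⟩
    simpa using ⟨rfl, T_zero _⟩
  | succ i ih =>
    have hlt : altLt (_root_.T (shiftn b 1)) (_root_.T (shiftn a 1)) := by
      refine ih (fun m hm => (hi (m + 1) (by omega)).symm) ?_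
      simp only [Nat.even_add_one, shiftn] at hi' ⊢
      split_ifs at hi' ⊢ <;> simp_all
    have h0 := hi 0 (Nat.succ_pos i)
    cases hb : b 0 <;> rw [hb] at h0
    · rw [T_of_false h0, T_of_false hb]
      exact hlt.wcons _
    · rw [T_of_true h0, T_of_true hb]
      exact ((hlt.wcons _).wcons _).wcons _

lemma altLe.T {a b : W2} (h : altLe a b) : altLe (T a) (T b) :=
  h.imp (fun h => by rw [h]) altLt.T

lemma altLe_of_T {a b : W2} (h : altLe (T a) (T b)) : altLe a b := by
  by_contra hle
  exact (altLt_of_not_altLe hle).T.not_altLe h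

lemma exists_shiftn_T_eq (a : W2) (k : ℕ) : ∃ l, shiftn (T a) l = T (shiftn a k) := by
  induction k with
  | zero => exact ⟨0, rfl⟩
  | succ k ih =>
    obtain ⟨l, hl⟩ := ih
    rw [← shiftn_shiftn]
    cases h : shiftn a k 0
    · exact ⟨l + 1, by rw [← shiftn_shiftn, hl, T_of_false h]; rfl⟩
    · exact ⟨l + 3, by rw [← shiftn_shiftn, hl, T_of_true h]; rfl⟩

lemma shiftn_T_cases (a : W2) (n : ℕ) :
    (∃ k, shiftn (T a) n = T (shiftn a k)) ∨ T a n = false := by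
  induction n using Nat.strong_induction_on generalizing a with
  | _ n ih =>
    have step : ∀ d m, 0 < d → n = d + m → shiftn (T a) d = T (shiftn a 1) →
        (∃ k, shiftn (T a) n = T (shiftn a k)) ∨ T a n = false := by
      rintro d m hd rfl hT
      refine (ih m (by omega) (shiftn a 1)).imp ?_ fun h => ?_
      · rintro ⟨k, hk⟩
        exact ⟨1 + k, by rw [← shiftn_shiftn, hT, hk, shiftn_shiftn]⟩
      · rw [← hT] at h
        rwa [add_comm]
    cases h : a 0
    · match n, step with
      | 0, _ => exact .inl ⟨0, rfl⟩
      | n + 1, step => exact step 1 n one_pos (by omega) (by rw [T_of_false h]; rfl)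
    · match n, step with
      | 0, _ => exact .inl ⟨0, rfl⟩
      | 1, _ => exact .inr (by rw [T_of_true h]; rfl)
      | 2, _ => exact .inr (by rw [T_of_true h]; rfl)
      | n + 3, step => exact step 3 n (by omega) (by omega) (by rw [T_of_true h]; rfl)

lemma T_mem_supWords_iff {a : W2} : T a ∈ supWords altLe ↔ a ∈ supWords altLe := by
  rw [mem_supWords_iff, mem_supWords_iff]
  constructor
  · intro h k
    obtain ⟨l, hl⟩ := exists_shiftn_T_eq a k
    exact altLe_of_T (hl ▸ h l)
  · intro h n
    rcases shiftn_T_cases a n with ⟨k, hk⟩ | hn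
    · rw [hk]
      exact (h k).T
    · exact .inr ⟨0, by simp, by simpa [shiftn, T_zero] using hn⟩

lemma exists_T_eq {a : W2} (h0 : a 0 = true)
    (h : ∀ n, a n = true → a (n + 1) = false → a (n + 2) = false ∧ a (n + 3) = true) :
    ∃ b, a = T b := by
  let next : ℕ → ℕ := fun p => if a (p + 1) = true then p + 1 else p + 3
  let p : ℕ → ℕ := fun k => next^[k] 0
  let b : W2 := fun k => !(a (p k + 1))
  have hp_succ : ∀ k, p (k + 1) = next (p k) := fun k => Function.iterate_succ_apply' _ _ _
  have hp : ∀ k, a (p k) = true := by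
    intro k
    induction k with
    | zero => exact h0
    | succ k ih =>
      rw [hp_succ]
      by_cases h1 : a (p k + 1) = true
      · simp [next, h1]
      · simp only [next, if_neg h1]
        exact (h _ ih (by simpa using h1)).2
  have key : ∀ n k, T (shiftn b k) n = a (p k + n) := by
    intro n
    induction n using Nat.strong_induction_on with
    | _ n ih =>
      intro k
      have hs : shiftn (shiftn b k) 1 = shiftn b (k + 1) := shiftn_shiftn _ _ _
      have hb : shiftn b k 0 = !(a (p k + 1)) := by simp [shiftn, b]
      cases h1 : a (p k + 1)
      · have hp1 : p (k + 1) = p k + 3 := by rw [hp_succ]; simp [next, h1]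
        rw [T_of_true (by rw [hb, h1]; rfl), hs]
        match n, ih with
        | 0, _ => exact (hp k).symm
        | 1, _ => exact h1.symm
        | 2, _ => exact (h _ (hp k) h1).1.symm
        | n + 3, ih =>
          refine (ih n (by omega) (k + 1)).trans ?_
          rw [hp1]
          congr 1
          omega
      · have hp1 : p (k + 1) = p k + 1 := by rw [hp_succ]; simp [next, h1]
        rw [T_of_false (by rw [hb, h1]; rfl), hs]
        match n, ih with
        | 0, _ => exact (hp k).symm
        | n + 1, ih =>
          refine (ih n (by omega) (k + 1)).trans ?_
          rw [hp1]
          congr 1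
          omega
  refine ⟨b, funext fun n => ?_⟩
  have := key n 0
  rw [shiftn_zero] at this
  rw [this]
  exact congrArg a (Nat.zero_add n).symm

/-! ### The fixed point -/

lemma T_agree {a b : W2} {N : ℕ} (h : ∀ i < N, a i = b i) : ∀ i < N + 1, T a i = T b i := by
  induction N generalizing a b with
  | zero =>
    intro i hi
    obtain rfl : i = 0 := by omega
    rw [T_zero, T_zero]
  | succ N ih =>
    have hs := ih (a := shiftn a 1) (b := shiftn b 1) fun i hi => h (i + 1) (by omega)
    have h0 := h 0 (Nat.succ_pos N)
    intro i hi
    cases hb : b 0 <;> rw [hb] at h0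
    · rw [T_of_false h0, T_of_false hb]
      match i with
      | 0 => rfl
      | i + 1 => exact hs i (by omega)
    · rw [T_of_true h0, T_of_true hb]
      match i with
      | 0 => rfl
      | 1 => rfl
      | 2 => rfl
      | i + 3 => exact hs i (by omega)

lemma T_iterate_agree (a b : W2) (n : ℕ) : ∀ i < n, T^[n] a i = T^[n] b i := by
  induction n with
  | zero => simp
  | succ n ih =>
    rw [Function.iterate_succ_apply', Function.iterate_succ_apply']
    exact T_agree ih

/-- The fixed point of the substitution `0 ↦ 1, 1 ↦ 100`. -/
def mAlt : W2 := fun n => T^[n + 1] w0 n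

lemma T_iterate_w0_agree (n : ℕ) : ∀ i < n, T^[n] w0 i = mAlt i := by
  intro i hi
  obtain ⟨d, rfl⟩ := Nat.exists_eq_add_of_lt hi
  rw [show i + d + 1 = (i + 1) + d by omega, Function.iterate_add_apply]
  exact T_iterate_agree _ _ (i + 1) i (Nat.lt_succ_self i)

lemma T_mAlt : T mAlt = mAlt := by
  funext n
  rw [← T_agree (T_iterate_w0_agree (n + 1)) n (by omega), ← Function.iterate_succ_apply' T]
  exact T_iterate_w0_agree (n + 2) n (by omega)

lemma T_iterate_mAlt (n : ℕ) : T^[n] mAlt = mAlt := Function.iterate_fixed T_mAlt n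

lemma mAlt_zero : mAlt 0 = true := by rw [← T_mAlt, T_zero]

lemma mAlt_eq : mAlt = wcons true (wcons false (wcons false (T (shiftn mAlt 1)))) := by
  rw [← T_of_true mAlt_zero, T_mAlt]

lemma mAlt_one : mAlt 1 = false := by rw [mAlt_eq]; rfl

lemma mAlt_two : mAlt 2 = false := by rw [mAlt_eq]; rfl

lemma mAlt_three : mAlt 3 = true := by rw [mAlt_eq]; exact T_zero (shiftn mAlt 1)

lemma T_iterate_w0_altLt (n : ℕ) : altLt (T^[n] w0) mAlt := by
  induction n with
  | zero => exact ⟨0, by simp, by simpa [w0] using mAlt_zero⟩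
  | succ n ih =>
    rw [Function.iterate_succ_apply', ← T_mAlt]
    exact ih.T

lemma T_iterate_w0_mem_supWords (n : ℕ) : T^[n] w0 ∈ supWords altLe := by
  induction n with
  | zero => exact mem_supWords_iff.mpr fun k => .inl rfl
  | succ n ih =>
    rw [Function.iterate_succ_apply']
    exact T_mem_supWords_iff.mpr ih

lemma eq_w0_or_exists_T_eq {a : W2} (ha : a ∈ supWords altLe) (ham : altLe a mAlt) :
    a = w0 ∨ ∃ b ∈ supWords altLe, altLe b mAlt ∧ a = T b := by
  have hM := mem_supWords_iff.mp ha
  by_cases hw : ∃ k, a k = true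
  swap
  · exact .inl (funext fun k => by simpa [w0] using fun h => hw ⟨k, h⟩)
  right
  obtain ⟨k, hk⟩ := hw
  have h0 : a 0 = true := by
    by_contra h
    exact altLt.not_altLe ⟨0, by simp, by simpa [shiftn, hk] using h⟩ (hM k)
  have key : ∀ n, a n = true → a (n + 1) = false → a (n + 2) = false ∧ a (n + 3) = true := by
    intro n hn hn1
    have e0 : shiftn a n 0 = true := by simpa [shiftn] using hn
    have e1 : shiftn a n 1 = false := by simpa [shiftn, add_comm] using hn1
    have h1 : a 1 = false := by
      by_contra h
      refine altLt.not_altLe ⟨1, fun m hm => ?_, ?_⟩ (hM n)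
      · interval_cases m; rw [h0, e0]
      · simpa [e1] using h
    have h2 : a 2 = false := by
      by_contra h
      refine altLt.not_altLe ⟨2, fun m hm => ?_, ?_⟩ ham
      · interval_cases m <;> simp [h0, h1, mAlt_zero, mAlt_one]
      · simpa [mAlt_two] using h
    have e2 : shiftn a n 2 = false := by
      by_contra h
      refine altLt.not_altLe ⟨2, fun m hm => ?_, ?_⟩ (hM n)
      · interval_cases m <;> simp [h0, h1, e0, e1]
      · simpa [h2] using h
    have h3 : a 3 = true := by
      by_contra h
      refine altLt.not_altLe ⟨3, fun m hm => ?_, ?_⟩ ham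
      · interval_cases m <;> simp [h0, h1, h2, mAlt_zero, mAlt_one, mAlt_two]
      · rw [if_neg (by decide)]
        exact ⟨mAlt_three, by simpa using h⟩
    have e3 : shiftn a n 3 = true := by
      by_contra h
      refine altLt.not_altLe ⟨3, fun m hm => ?_, ?_⟩ (hM n)
      · interval_cases m <;> simp [h0, h1, h2, e0, e1, e2]
      · rw [if_neg (by decide)]
        exact ⟨h3, by simpa using h⟩
    rw [add_comm n 2, add_comm n 3]
    exact ⟨e2, e3⟩
  obtain ⟨b, rfl⟩ := exists_T_eq h0 key
  exact ⟨b, T_mem_supWords_iff.mp ha, altLe_of_T (by rwa [T_mAlt]), rfl⟩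

lemma eq_T_iterate_w0_or_eq_mAlt {a : W2} (ha : a ∈ supWords altLe) (ham : altLe a mAlt) :
    (∃ n, a = T^[n] w0) ∨ a = mAlt := by
  by_cases h : ∃ n, a = T^[n] w0
  · exact .inl h
  right
  have key : ∀ n, ∃ b ∈ supWords altLe, altLe b mAlt ∧ a = T^[n] b := by
    intro n
    induction n with
    | zero => exact ⟨a, ha, ham, rfl⟩
    | succ n ih =>
      obtain ⟨b, hb, hbm, hab⟩ := ih
      rcases eq_w0_or_exists_T_eq hb hbm with rfl | ⟨c, hc, hcm, rfl⟩
      · exact absurd ⟨n, hab⟩ h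
      · exact ⟨c, hc, hcm, hab⟩
  funext i
  obtain ⟨b, -, -, hab⟩ := key (i + 1)
  rw [hab, ← T_iterate_mAlt (i + 1)]
  exact T_iterate_agree _ _ (i + 1) i (Nat.lt_succ_self i)

lemma isAccPt'_mAlt : IsAccPt' (supWords altLe) mAlt := by
  intro ε hε
  obtain ⟨n, hn⟩ := exists_pow_lt_of_lt_one hε (y := (2 : ℝ)⁻¹) (by norm_num)
  refine ⟨T^[n] w0, T_iterate_w0_mem_supWords n, fun h => ?_, (wdist_lt_of_agree ?_).trans hn⟩
  · exact altLt_irrefl _ (h ▸ T_iterate_w0_altLt n)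
  · exact fun i hi => (T_iterate_w0_agree n i hi).symm

lemma mAlt_altLe_of_isAccPt' {y : W2} (hy : IsAccPt' (supWords altLe) y) : altLe mAlt y := by
  by_contra hle
  obtain ⟨i, hi, hi'⟩ := altLt_of_not_altLe hle
  have hne : y i ≠ mAlt i := by
    split_ifs at hi' <;> simp [hi']
  have hdiff : ∀ n, ∃ j, T^[n] w0 ≠ y → y j ≠ T^[n] w0 j := by
    intro n
    by_cases h : T^[n] w0 = y
    · exact ⟨0, fun h' => absurd h h'⟩
    · obtain ⟨j, hj⟩ := Function.ne_iff.mp h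
      exact ⟨j, fun _ => hj.symm⟩
  choose j hj using hdiff
  let N := max i ((Finset.range (i + 1)).sup j) + 1
  obtain ⟨z, hz, hzy, hd⟩ := hy ((2 : ℝ)⁻¹ ^ N) (by positivity)
  have hagree := agree_of_wdist_lt hd
  have hzi : y i = z i := hagree i (by omega)
  have hzm : altLt z mAlt :=
    ⟨i, fun m hm => by rw [← hagree m (by omega), hi m hm], by rwa [← hzi]⟩
  rcases eq_T_iterate_w0_or_eq_mAlt hz (.inr hzm) with ⟨n, rfl⟩ | rfl
  · by_cases hn : i < n
    · exact hne (hzi.trans (T_iterate_w0_agree n i hn))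
    · have : j n ≤ (Finset.range (i + 1)).sup j :=
        Finset.le_sup (f := j) (Finset.mem_range.mpr (by omega))
      exact hj n hzy (hagree (j n) (by omega))
  · exact altLt_irrefl _ hzm

/-! ### Periodic words -/

lemma subApply_tauS_wappend (j k : ℕ) (l : List Bool) (a : W2) :
    subApply (tauS j k) (wappend l a) =
      wappend (listApply (tauS j k) l) (subApply (tauS j k) a) := by
  induction l with
  | nil => rfl
  | cons x l ih =>
    have : wappend (x :: l) a = wcons x (wappend l a) := rfl
    rw [this, subApply_tauS_wcons, ih]
    simp [wappend, listApply]

lemma wappend_apply_of_lt {l : List Bool} (a : W2) {n : ℕ} (h : n < l.length) :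
    wappend l a n = l.getD n false := by
  induction l generalizing n with
  | nil => simp at h
  | cons x l ih =>
    cases n with
    | zero => rfl
    | succ n => exact ih (n := n) (by simpa using h)

lemma wappend_apply_add (l : List Bool) (a : W2) (n : ℕ) : wappend l a (n + l.length) = a n := by
  induction l with
  | nil => rfl
  | cons x l ih => exact ih

lemma eq_perW_of_wappend_eq {l : List Bool} (hl : l ≠ []) {a : W2} (h : wappend l a = a) :
    a = perW l := by
  have hper : Function.Periodic a l.length := fun n => by
    conv_lhs => rw [← h]
    exact wappend_apply_add l a n
  funext n
  rw [← hper.map_mod_nat n, ← h, wappend_apply_of_lt _ (Nat.mod_lt _ (List.length_pos_iff.mpr hl))]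
  rfl

lemma T_iterate_w0_eq_perW (n : ℕ) : T^[n] w0 = perW (tauIter02 n) := by
  have key : tauIter02 n ≠ [] ∧ wappend (tauIter02 n) (T^[n] w0) = T^[n] w0 := by
    induction n with
    | zero =>
      refine ⟨by simp [tauIter02], ?_⟩
      exact wcons_head_tail w0
    | succ n ih =>
      constructor
      · rw [← List.length_pos_iff] at ih ⊢
        exact ih.1.trans_le (length_le_length_listApply_tauS 0 2 _)
      · rw [Function.iterate_succ_apply']
        conv_rhs => rw [← ih.2]
        exact (subApply_tauS_wappend 0 2 _ _).symm
  exact eq_perW_of_wappend_eq key.1 key.2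

/-- The alternating lexicographic order is a cylinder order, its smallest
accumulation point `m_alt` is the fixed point of `τ_{0,2} : 0 ↦ 1, 1 ↦ 100`, and
`{a ∈ M_alt : a <_alt m_alt} = {(τ_{0,2}^n(0))^∞ : n ≥ 0}`. -/
theorem stmt_11 :
    IsCylOrder altLe ∧
      ∃ m : W2, IsSmallestAcc altLe (supWords altLe) m ∧
        m = subApply (tauS 0 2) m ∧
        {a ∈ supWords altLe | wlt altLe a m} = {a | ∃ n : ℕ, a = perW (tauIter02 n)} := by
  refine ⟨isCylOrder_altLe, mAlt, ⟨isAccPt'_mAlt, fun y => mAlt_altLe_of_isAccPt'⟩,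
    T_mAlt.symm, ?_⟩
  ext a
  simp only [Set.mem_ofPred_eq, ← T_iterate_w0_eq_perW]
  constructor
  · rintro ⟨ha, ham, hne⟩
    exact (eq_T_iterate_w0_or_eq_mAlt ha ham).resolve_right hne
  · rintro ⟨n, rfl⟩
    have hlt := T_iterate_w0_altLt n
    exact ⟨T_iterate_w0_mem_supWords n, .inr hlt, fun h => altLt_irrefl _ (h ▸ hlt)⟩
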